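/- Fix a₁, a₂, b₁, b₂ ∈ ℝ, all nonzero, with b₁ ≠ b₂. Let W(x) = e^{−x²}·[[1 + a₁²x²e^{2b₁x}, a₁x e^{2b₁x}, a₁a₂x² e^{2b₁x}],[a₁x e^{2b₁x}, e^{2b₁x}, a₂x e^{2b₁x}],[a₁a₂x² e^{2b₁x}, a₂x e^{2b₁x}, a₂²x² e^{2b₁x} + e^{2b₂x}]] and let F₂ = I, F₁(x) = [[−2x, 2a₁b₁x + 2a₁, 0],[0, 2b₁ − 2x, 0],[0, (2a₂b₁ − 2a₂b₂)x + 2a₂, 2b₂ − 2x]], F₀ = [[0, 2a₁b₁, 0],[0, 2, 0],[0, 2a₂b₁, 0]]. Then the second-order symmetry equations hold for all x ∈ ℝ: F₂W = W F₂ᵀ, 2(F₂W)′ − F₁W = W F₁ᵀ, and (F₂W)″ − (F₁W)′ + F₀W = W F₀ᵀ, with entrywise derivatives. Hence the operator D = ∂²F₂ + ∂F₁ + F₀ is symmetric with respect to the 3×3 weight W. -/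

import Mathlib

open Matrix

/-- The `3×3` weight matrix `W(x)`. -/
noncomputable def W3 (a₁ a₂ b₁ b₂ : ℝ) (x : ℝ) : Matrix (Fin 3) (Fin 3) ℝ :=
  Real.exp (-x^2) •
    !![1 + a₁^2*x^2*Real.exp (2*b₁*x), a₁*x*Real.exp (2*b₁*x), a₁*a₂*x^2*Real.exp (2*b₁*x);
       a₁*x*Real.exp (2*b₁*x), Real.exp (2*b₁*x), a₂*x*Real.exp (2*b₁*x);
       a₁*a₂*x^2*Real.exp (2*b₁*x), a₂*x*Real.exp (2*b₁*x),
         a₂^2*x^2*Real.exp (2*b₁*x) + Real.exp (2*b₂*x)]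

/-- Entrywise derivative of a matrix-valued function on `ℝ`. -/
noncomputable def mderiv (G : ℝ → Matrix (Fin 3) (Fin 3) ℝ) (x : ℝ) :
    Matrix (Fin 3) (Fin 3) ℝ :=
  Matrix.of fun i j => deriv (fun t => G t i j) x

/-- `F₂ = I`. -/
noncomputable def F2 : ℝ → Matrix (Fin 3) (Fin 3) ℝ := fun _ => 1

/-- `F₁(x)`. -/
noncomputable def F1 (a₁ a₂ b₁ b₂ : ℝ) (x : ℝ) : Matrix (Fin 3) (Fin 3) ℝ :=
  !![-2*x, 2*a₁*b₁*x + 2*a₁, 0;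
     0, 2*b₁ - 2*x, 0;
     0, (2*a₂*b₁ - 2*a₂*b₂)*x + 2*a₂, 2*b₂ - 2*x]

/-- `F₀`. -/
noncomputable def F0 (a₁ a₂ b₁ : ℝ) : Matrix (Fin 3) (Fin 3) ℝ :=
  !![0, 2*a₁*b₁, 0;
     0, 2, 0;
     0, 2*a₂*b₁, 0]

lemma hasDerivAt_exp_neg_sq (x : ℝ) :
    HasDerivAt (fun t : ℝ => Real.exp (-t^2)) (-(2*x) * Real.exp (-x^2)) x := by
  have h := ((hasDerivAt_pow 2 x).fun_neg).exp
  convert h using 1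
  push_cast
  ring

lemma hasDerivAt_exp_two_mul (b x : ℝ) :
    HasDerivAt (fun t : ℝ => Real.exp (2*b*t)) (2*b * Real.exp (2*b*x)) x := by
  have h := ((hasDerivAt_id' x).const_mul (2*b)).exp
  convert h using 1
  ring

/-- The common shape of all entries of the weight. -/
lemma hasDerivAt_weight_entry (b₁ b₂ k c m x : ℝ) (n : ℕ) :
    HasDerivAt (fun t : ℝ => Real.exp (-t^2) *
        (k + c*t^n*Real.exp (2*b₁*t) + m*Real.exp (2*b₂*t)))
      (Real.exp (-x^2) * (-(2*x)*(k + c*x^n*Real.exp (2*b₁*x) + m*Real.exp (2*b₂*x))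
        + c*(n*x^(n-1) + 2*b₁*x^n)*Real.exp (2*b₁*x) + 2*b₂*m*Real.exp (2*b₂*x))) x := by
  have h := (hasDerivAt_exp_neg_sq x).fun_mul
    (((((hasDerivAt_pow n x).const_mul c).fun_mul
      (hasDerivAt_exp_two_mul b₁ x)).const_add k).fun_add
      ((hasDerivAt_exp_two_mul b₂ x).const_mul m))
  refine h.congr_deriv ?_
  ring

/-- The derivative of the weight is half of `F₁W + WF₁ᵀ`. -/
lemma mderiv_W3 (a₁ a₂ b₁ b₂ x : ℝ) :
    mderiv (W3 a₁ a₂ b₁ b₂) x = (1/2 : ℝ) •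
      (F1 a₁ a₂ b₁ b₂ x * W3 a₁ a₂ b₁ b₂ x + W3 a₁ a₂ b₁ b₂ x * (F1 a₁ a₂ b₁ b₂ x)ᵀ) := by
  have entry (i j : Fin 3) (k c m : ℝ) (n : ℕ) (h : ∀ t, W3 a₁ a₂ b₁ b₂ t i j =
      Real.exp (-t^2) * (k + c*t^n*Real.exp (2*b₁*t) + m*Real.exp (2*b₂*t))) :=
    (funext h : (fun t => W3 a₁ a₂ b₁ b₂ t i j) = _) ▸
      (hasDerivAt_weight_entry b₁ b₂ k c m x n).deriv
  have e₀₀ := entry 0 0 1 (a₁^2) 0 2 (by simp [W3])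
  have e₀₁ := entry 0 1 0 a₁ 0 1 (by simp [W3])
  have e₀₂ := entry 0 2 0 (a₁*a₂) 0 2 (by simp [W3])
  have e₁₀ := entry 1 0 0 a₁ 0 1 (by simp [W3])
  have e₁₁ := entry 1 1 0 1 0 0 (by simp [W3])
  have e₁₂ := entry 1 2 0 a₂ 0 1 (by simp [W3])
  have e₂₀ := entry 2 0 0 (a₁*a₂) 0 2 (by simp [W3])
  have e₂₁ := entry 2 1 0 a₂ 0 1 (by simp [W3])
  have e₂₂ := entry 2 2 0 (a₂^2) 1 2 (by simp [W3])
  ext i j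
  simp only [mderiv, Matrix.of_apply, Matrix.add_apply, Matrix.smul_apply, Matrix.mul_apply,
    Matrix.transpose_apply, Fin.sum_univ_three]
  fin_cases i <;> fin_cases j <;> dsimp only [Fin.zero_eta, Fin.mk_one, Fin.reduceFinMk] <;>
    simp only [e₀₀, e₀₁, e₀₂, e₁₀, e₁₁, e₁₂, e₂₀, e₂₁, e₂₂] <;> simp [W3, F1] <;> ring

/-- The derivative of the weight and `F₁W` differ by an explicit antisymmetric matrix. -/
lemma mderiv_W3_eq_F1_mul_add (a₁ a₂ b₁ b₂ x : ℝ) :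
    mderiv (W3 a₁ a₂ b₁ b₂) x = F1 a₁ a₂ b₁ b₂ x * W3 a₁ a₂ b₁ b₂ x +
      (Real.exp (-x^2) * Real.exp (2*b₁*x)) • !![0, -a₁, 0; a₁, 0, a₂; 0, -a₂, 0] := by
  rw [mderiv_W3]
  ext i j
  simp only [Matrix.add_apply, Matrix.smul_apply, Matrix.mul_apply, Matrix.transpose_apply,
    Fin.sum_univ_three]
  fin_cases i <;> fin_cases j <;> simp [W3, F1] <;> ring

lemma mderiv_add {G H : ℝ → Matrix (Fin 3) (Fin 3) ℝ} {x : ℝ}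
    (hG : ∀ i j, DifferentiableAt ℝ (fun t => G t i j) x)
    (hH : ∀ i j, DifferentiableAt ℝ (fun t => H t i j) x) :
    mderiv (fun t => G t + H t) x = mderiv G x + mderiv H x := by
  ext i j
  exact deriv_fun_add (hG i j) (hH i j)

lemma mderiv_smul_const {g : ℝ → ℝ} {g' x : ℝ} (hg : HasDerivAt g g' x)
    (M : Matrix (Fin 3) (Fin 3) ℝ) : mderiv (fun t => g t • M) x = g' • M := by
  ext i j
  exact (hg.mul_const (M i j)).deriv

lemma differentiable_W3 (a₁ a₂ b₁ b₂ : ℝ) (i j : Fin 3) :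
    Differentiable ℝ (fun t => W3 a₁ a₂ b₁ b₂ t i j) := by
  fin_cases i <;> fin_cases j <;> simp [W3] <;> fun_prop

lemma differentiable_F1 (a₁ a₂ b₁ b₂ : ℝ) (i j : Fin 3) :
    Differentiable ℝ (fun t => F1 a₁ a₂ b₁ b₂ t i j) := by
  fin_cases i <;> fin_cases j <;> simp [F1] <;> fun_prop

/-- The second-order symmetry equations hold for the `3×3` weight `W`, so the
operator `D = ∂²F₂ + ∂F₁ + F₀` is symmetric with respect to `W`. -/
theorem stmt19 (a₁ a₂ b₁ b₂ : ℝ) (ha₁ : a₁ ≠ 0) (ha₂ : a₂ ≠ 0)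
    (hb₁ : b₁ ≠ 0) (hb₂ : b₂ ≠ 0) (hb : b₁ ≠ b₂) (x : ℝ) :
    F2 x * W3 a₁ a₂ b₁ b₂ x = W3 a₁ a₂ b₁ b₂ x * (F2 x)ᵀ ∧
    (2 : ℝ) • mderiv (fun t => F2 t * W3 a₁ a₂ b₁ b₂ t) x
        - F1 a₁ a₂ b₁ b₂ x * W3 a₁ a₂ b₁ b₂ x
      = W3 a₁ a₂ b₁ b₂ x * (F1 a₁ a₂ b₁ b₂ x)ᵀ ∧
    mderiv (mderiv (fun t => F2 t * W3 a₁ a₂ b₁ b₂ t)) x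
        - mderiv (fun t => F1 a₁ a₂ b₁ b₂ t * W3 a₁ a₂ b₁ b₂ t) x
        + F0 a₁ a₂ b₁ * W3 a₁ a₂ b₁ b₂ x
      = W3 a₁ a₂ b₁ b₂ x * (F0 a₁ a₂ b₁)ᵀ := by
  have hF2 : (fun t => F2 t * W3 a₁ a₂ b₁ b₂ t) = W3 a₁ a₂ b₁ b₂ := by
    funext t
    simp [F2]
  rw [hF2]
  refine ⟨by simp [F2], ?_, ?_⟩
  · rw [mderiv_W3, smul_smul]
    norm_num
  · have hg := (hasDerivAt_exp_neg_sq x).fun_mul (hasDerivAt_exp_two_mul b₁ x)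
    rw [funext (mderiv_W3_eq_F1_mul_add a₁ a₂ b₁ b₂), mderiv_add, add_sub_cancel_left,
      mderiv_smul_const hg]
    · ext i j
      simp only [Matrix.add_apply, Matrix.smul_apply, Matrix.mul_apply, Matrix.transpose_apply,
        Fin.sum_univ_three]
      fin_cases i <;> fin_cases j <;> simp [W3, F0] <;> ring
    · intro i j
      simp only [Matrix.mul_apply]
      exact DifferentiableAt.fun_sum fun k _ =>
        ((differentiable_F1 a₁ a₂ b₁ b₂ i k) x).mul ((differentiable_W3 a₁ a₂ b₁ b₂ k j) x)
    · intro i j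
      exact hg.differentiableAt.mul_const _
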